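/- For all integers 1 ≤ k < p < n, the norm-comparison constants satisfy C_{n,p}² ≤ (C(n, p-k) / C(p, k)) · C_{n,k}², where C(a,b) denotes the binomial coefficient a choose b. -/

import Mathlib

open scoped Classical

/-- A `p`-covector on `ℝⁿ`: a continuous alternating `p`-linear form on
`EuclideanSpace ℝ (Fin n)`. -/
abbrev Covector (n p : ℕ) := EuclideanSpace ℝ (Fin n) [⋀^Fin p]→L[ℝ] ℝ

/-- The comass of a real-valued function of `p` vectors in `ℝⁿ`: the supremum of
its absolute values on orthonormal families. -/
noncomputable def comassFun {n p : ℕ}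
    (F : (Fin p → EuclideanSpace ℝ (Fin n)) → ℝ) : ℝ :=
  sSup {r : ℝ | ∃ v : Fin p → EuclideanSpace ℝ (Fin n), Orthonormal ℝ v ∧ r = |F v|}

/-- The comass norm `‖φ‖*` of a `p`-covector. -/
noncomputable def comass {n p : ℕ} (φ : Covector n p) : ℝ :=
  comassFun (fun v => φ v)

/-- The Euclidean norm `|φ|*` of a `p`-covector, computed from its coefficients
on the standard orthonormal basis, indexed by strictly increasing multi-indices. -/
noncomputable def euclNorm {n p : ℕ} (φ : Covector n p) : ℝ :=
  Real.sqrt (∑ f : {f : Fin p → Fin n // StrictMono f},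
    (φ (fun i => EuclideanSpace.single (f.1 i) 1)) ^ 2)

/-- The norm-comparison constant `C_{n,p}`: the supremum of `|φ|*/‖φ‖*` over all
nonzero `p`-covectors on `ℝⁿ`. -/
noncomputable def normComparisonConst (n p : ℕ) : ℝ :=
  sSup {r : ℝ | ∃ φ : Covector n p, φ ≠ 0 ∧ r = euclNorm φ / comass φ}

lemma hadamard_volume {E : Type*} [NormedAddCommGroup E] [InnerProductSpace ℝ E] {p : ℕ}
    (f : E [⋀^Fin p]→ₗ[ℝ] ℝ) (C : ℝ)
    (hC : ∀ v : Fin p → E, Orthonormal ℝ v → |f v| ≤ C) (hC0 : 0 ≤ C) (w : Fin p → E) :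
    |f w| ≤ C * ∏ i, ‖w i‖ := by
  by_cases hw : LinearIndependent ℝ w
  · let W := Submodule.span ℝ (Set.range w)
    have hfr : Module.finrank ℝ W = p := by
      have := finrank_span_eq_card hw
      simpa using this
    have : FiniteDimensional ℝ W := FiniteDimensional.span_of_finite ℝ (Set.finite_range w)
    have : Fact (Module.finrank ℝ W = p) := ⟨hfr⟩
    let b : OrthonormalBasis (Fin p) ℝ W := (stdOrthonormalBasis ℝ W).reindex (finCongr hfr)
    let g : W [⋀^Fin p]→ₗ[ℝ] ℝ := f.compLinearMap W.subtype
    let w' : Fin p → W := fun i => ⟨w i, Submodule.subset_span ⟨i, rfl⟩⟩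
    let o : Orientation ℝ W (Fin p) := b.toBasis.orientation
    have h1 : f w = g b * b.toBasis.det w' := by
      have h := g.eq_smul_basis_det b.toBasis
      have h' := congrArg (fun q => q w') h
      simpa [g, w'] using h'
    have h2 : |b.toBasis.det w'| ≤ ∏ i, ‖w i‖ := by
      rw [← o.volumeForm_robust' b w']
      exact o.abs_volumeForm_apply_le w'
    have h3 : |g b| ≤ C := by
      apply hC
      exact b.orthonormal.comp_linearIsometry W.subtypeₗᵢ
    rw [h1, abs_mul]
    exact mul_le_mul h3 h2 (abs_nonneg _) hC0
  · rw [f.map_linearDependent w hw]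
    simp only [abs_zero]
    positivity

lemma comass_bdd {n p : ℕ} (φ : Covector n p) :
    BddAbove {r : ℝ | ∃ v : Fin p → EuclideanSpace ℝ (Fin n), Orthonormal ℝ v ∧ r = |φ v|} := by
  refine ⟨‖φ‖, ?_⟩
  rintro r ⟨v, hv, rfl⟩
  have := φ.le_opNorm v
  simpa [hv.1] using this

lemma le_comass {n p : ℕ} (φ : Covector n p) (v : Fin p → EuclideanSpace ℝ (Fin n))
    (hv : Orthonormal ℝ v) : |φ v| ≤ comass φ :=
  le_csSup (comass_bdd φ) ⟨v, hv, rfl⟩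

lemma comass_nonneg {n p : ℕ} (φ : Covector n p) : 0 ≤ comass φ := by
  apply Real.sSup_nonneg
  rintro r ⟨v, -, rfl⟩
  exact abs_nonneg _

lemma le_comass_unit {n p : ℕ} (φ : Covector n p) (v : Fin p → EuclideanSpace ℝ (Fin n))
    (hv : ∀ i, ‖v i‖ = 1) : |φ v| ≤ comass φ := by
  have := hadamard_volume φ.toAlternatingMap (comass φ) (fun v hv => le_comass φ v hv)
    (comass_nonneg φ) v
  simpa [hv] using this

lemma euclNorm_sq {n p : ℕ} (φ : Covector n p) :
    euclNorm φ ^ 2 = ∑ f : {f : Fin p → Fin n // StrictMono f},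
      (φ (fun i => EuclideanSpace.single (f.1 i) 1)) ^ 2 :=
  Real.sq_sqrt (Finset.sum_nonneg fun _ _ => sq_nonneg _)

lemma euclNorm_le_card {n p : ℕ} (φ : Covector n p) :
    euclNorm φ ≤ Real.sqrt (Fintype.card {f : Fin p → Fin n // StrictMono f}) * comass φ := by
  rw [← Real.sqrt_sq (comass_nonneg φ), ← Real.sqrt_mul (by positivity)]
  apply Real.sqrt_le_sqrt
  calc _ ≤ ∑ f : {f : Fin p → Fin n // StrictMono f}, comass φ ^ 2 := by
        apply Finset.sum_le_sum
        intro f _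
        rw [← sq_abs]
        have := le_comass_unit φ (fun i => EuclideanSpace.single (f.1 i) 1) (by simp)
        gcongr
    _ = _ := by simp

lemma const_bdd (n p : ℕ) :
    BddAbove {r : ℝ | ∃ φ : Covector n p, φ ≠ 0 ∧ r = euclNorm φ / comass φ} := by
  refine ⟨Real.sqrt (Fintype.card {f : Fin p → Fin n // StrictMono f}), ?_⟩
  rintro r ⟨φ, -, rfl⟩
  exact div_le_of_le_mul₀ (comass_nonneg φ) (Real.sqrt_nonneg _) (euclNorm_le_card φ)

lemma const_nonneg (n p : ℕ) : 0 ≤ normComparisonConst n p := by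
  apply Real.sSup_nonneg
  rintro r ⟨φ, -, rfl⟩
  exact div_nonneg (Real.sqrt_nonneg _) (comass_nonneg φ)

lemma euclNorm_le_const {n p : ℕ} (φ : Covector n p) :
    euclNorm φ ≤ normComparisonConst n p * comass φ := by
  rcases (comass_nonneg φ).eq_or_lt with h | h
  · have := euclNorm_le_card φ
    rw [← h] at this ⊢
    simpa using this
  · rw [← div_le_iff₀ h]
    apply le_csSup (const_bdd n p)
    refine ⟨φ, ?_, rfl⟩
    rintro rfl
    have h0 : comass (0 : Covector n p) ≤ 0 := by
      apply Real.sSup_le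
      · rintro r ⟨v, -, rfl⟩
        simp
      · exact le_rfl
    linarith

/-- Sum over all multi-indices versus strictly increasing ones. -/
lemma sum_all_eq {n p : ℕ} (F : (Fin p → Fin n) → ℝ)
    (hF : ∀ f (σ : Equiv.Perm (Fin p)), F (f ∘ σ) = F f)
    (h0 : ∀ f, ¬ Function.Injective f → F f = 0) :
    ∑ f, F f = (p.factorial : ℝ) * ∑ f : {f : Fin p → Fin n // StrictMono f}, F f.1 := by
  have h1 : ∑ x : {f : Fin p → Fin n // StrictMono f} × Equiv.Perm (Fin p), F (x.1.1 ∘ x.2)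
      = ∑ f with Function.Injective f, F f := by
    refine Finset.sum_bij (fun x _ => x.1.1 ∘ x.2) ?_ ?_ ?_ ?_
    · rintro ⟨s, σ⟩ -
      simp only [Finset.mem_filter, Finset.mem_univ, true_and]
      exact s.2.injective.comp σ.injective
    · rintro ⟨⟨s, hs⟩, σ⟩ - ⟨⟨t, ht⟩, τ⟩ - h
      dsimp only at h
      have hr : Set.range s = Set.range t := by
        rw [← σ.surjective.range_comp s, h, τ.surjective.range_comp]
      have hst : s = t := (hs.range_inj ht).1 hr
      subst hst
      have : σ = τ := by
        ext i
        have := hs.injective (congrFun h i)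
        rw [this]
      subst this
      rfl
    · intro f hf
      simp only [Finset.mem_filter, Finset.mem_univ, true_and] at hf
      refine ⟨⟨⟨f ∘ Tuple.sort f, (Tuple.monotone_sort f).strictMono_of_injective
        (hf.comp (Tuple.sort f).injective)⟩, (Tuple.sort f)⁻¹⟩, Finset.mem_univ _, ?_⟩
      ext i
      simp
    · intros; rfl
  have h2 : ∑ f with Function.Injective f, F f = ∑ f, F f := by
    rw [Finset.sum_filter]
    refine Finset.sum_congr rfl fun f _ => ?_
    split_ifs with h
    · rfl
    · exact (h0 f h).symm
  rw [← h2, ← h1, Fintype.sum_prod_type, Finset.mul_sum]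
  refine Finset.sum_congr rfl fun s _ => ?_
  simp [hF, Fintype.card_perm]

lemma sum_all_covector {n p : ℕ} (φ : Covector n p) :
    ∑ f : Fin p → Fin n, (φ (fun i => EuclideanSpace.single (f i) 1)) ^ 2
      = (p.factorial : ℝ) * euclNorm φ ^ 2 := by
  rw [euclNorm_sq]
  apply sum_all_eq (fun f => (φ (fun i => EuclideanSpace.single (f i) 1)) ^ 2)
  · intro f σ
    have := φ.toAlternatingMap.map_perm (fun i => EuclideanSpace.single (f i) (1 : ℝ)) σ
    have h2 : φ (fun i => EuclideanSpace.single ((f ∘ σ) i) (1 : ℝ)) =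
      Equiv.Perm.sign σ • φ (fun i => EuclideanSpace.single (f i) (1 : ℝ)) := this
    rw [h2]
    rcases Int.units_eq_one_or (Equiv.Perm.sign σ) with h | h <;> simp [h]
  · intro f hf
    have : φ (fun i => EuclideanSpace.single (f i) (1 : ℝ)) = 0 := by
      simp only [Function.Injective, not_forall] at hf
      obtain ⟨i, j, hij, hne⟩ := hf
      exact φ.map_eq_zero_of_eq _ (by simp [hij]) hne
    simp [this]

lemma append_upd {α : Type*} {m k : ℕ} [DecidableEq (Fin k)] (a : Fin m → α) (v : Fin k → α)
    (i : Fin k) (x : α) :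
    Fin.append a (Function.update v i x) =
      Function.update (Fin.append a v) (Fin.natAdd m i) x := by
  ext j
  refine Fin.addCases (fun j => ?_) (fun j => ?_) j
  · rw [Function.update_of_ne]
    · simp
    · intro h
      have := congrArg Fin.val h
      simp at this
      omega
  · by_cases h : j = i
    · subst h; simp
    · simp [Function.update_of_ne, h]

/-- Fix the first `m` arguments of a covector. -/
noncomputable def contr {n m k : ℕ} (φ : Covector n (m + k))
    (a : Fin m → EuclideanSpace ℝ (Fin n)) : Covector n k where
  toFun v := φ (Fin.append a v)
  map_update_add' v i x y := by
    simp only [append_upd]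
    exact φ.map_update_add _ _ _ _
  map_update_smul' v i c x := by
    simp only [append_upd]
    exact φ.map_update_smul _ _ _ _
  map_eq_zero_of_eq' v i j h hne := by
    refine φ.map_eq_zero_of_eq (i := Fin.natAdd m i) (j := Fin.natAdd m j) _ (by simpa using h) ?_
    simpa using hne
  cont := by
    refine φ.cont.comp (continuous_pi fun j => ?_)
    refine Fin.addCases (fun j => ?_) (fun j => ?_) j
    · simp only [Fin.append_left]; exact continuous_const
    · simp only [Fin.append_right]; exact continuous_apply j

lemma contr_apply {n m k : ℕ} (φ : Covector n (m + k))
    (a : Fin m → EuclideanSpace ℝ (Fin n)) (v : Fin k → EuclideanSpace ℝ (Fin n)) :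
    contr φ a v = φ (Fin.append a v) := rfl

lemma comass_contr_le {n m k : ℕ} (φ : Covector n (m + k))
    (a : Fin m → EuclideanSpace ℝ (Fin n)) (ha : ∀ i, ‖a i‖ = 1) :
    comass (contr φ a) ≤ comass φ := by
  apply Real.sSup_le _ (comass_nonneg φ)
  rintro r ⟨v, hv, rfl⟩
  show |φ (Fin.append a v)| ≤ _
  apply le_comass_unit
  intro j
  refine Fin.addCases (fun j => ?_) (fun j => ?_) j
  · simp [ha]
  · simp [hv.1]

lemma single_append {n m k : ℕ} (g : Fin m → Fin n) (h : Fin k → Fin n) :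
    (fun i => EuclideanSpace.single (Fin.append g h i) (1 : ℝ)) =
      Fin.append (fun i => EuclideanSpace.single (g i) (1 : ℝ))
        (fun i => EuclideanSpace.single (h i) (1 : ℝ)) := by
  funext j
  refine Fin.addCases (fun j => ?_) (fun j => ?_) j <;> simp

lemma key_sum {n m k : ℕ} (φ : Covector n (m + k)) :
    ((m + k).factorial : ℝ) * euclNorm φ ^ 2 =
      ∑ g : Fin m → Fin n, (k.factorial : ℝ) *
        euclNorm (contr φ (fun i => EuclideanSpace.single (g i) 1)) ^ 2 := by
  rw [← sum_all_covector, ← (Fin.appendEquiv m k).sum_comp, Fintype.sum_prod_type]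
  refine Finset.sum_congr rfl fun g _ => ?_
  rw [← sum_all_covector]
  refine Finset.sum_congr rfl fun h _ => ?_
  rw [contr_apply, ← single_append]
  rfl

lemma card_inj (n m : ℕ) :
    ((Finset.univ.filter fun g : Fin m → Fin n => Function.Injective g).card : ℝ)
      = m.factorial * n.choose m := by
  have h : (Finset.univ.filter fun g : Fin m → Fin n => Function.Injective g).card
      = n.descFactorial m := by
    rw [← Fintype.card_subtype, Fintype.card_congr (Equiv.subtypeInjectiveEquivEmbedding _ _)]
    simp [Fintype.card_embedding_eq]
  rw [h, Nat.descFactorial_eq_factorial_mul_choose]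
  push_cast
  rfl

lemma euclNorm_contr_zero {n m k : ℕ} (φ : Covector n (m + k)) (g : Fin m → Fin n)
    (hg : ¬ Function.Injective g) :
    euclNorm (contr φ (fun i => EuclideanSpace.single (g i) 1)) = 0 := by
  simp only [Function.Injective, not_forall] at hg
  obtain ⟨i, j, hij, hne⟩ := hg
  unfold euclNorm
  rw [Finset.sum_eq_zero, Real.sqrt_zero]
  intro f _
  rw [contr_apply, φ.map_eq_zero_of_eq (i := Fin.castAdd k i) (j := Fin.castAdd k j)]
  · simp
  · simp [hij]
  · simpa using hne

lemma main_bound {n m k : ℕ} (φ : Covector n (m + k)) :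
    euclNorm φ ^ 2 ≤ ((n.choose m : ℝ) / ((m + k).choose k : ℝ)) *
      normComparisonConst n k ^ 2 * comass φ ^ 2 := by
  have h1 : ((m + k).factorial : ℝ) * euclNorm φ ^ 2 ≤
      (m.factorial * n.choose m) * (k.factorial *
        (normComparisonConst n k * comass φ) ^ 2) := by
    rw [key_sum, ← card_inj, ← nsmul_eq_mul, ← Finset.sum_const, Finset.sum_filter]
    refine Finset.sum_le_sum fun g _ => ?_
    split_ifs with hg
    · have hb := euclNorm_le_const (contr φ (fun i => EuclideanSpace.single (g i) 1))
      have hc := comass_contr_le φ (fun i => EuclideanSpace.single (g i) 1) (by simp)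
      have h0 : 0 ≤ euclNorm (contr φ (fun i => EuclideanSpace.single (g i) 1)) :=
        Real.sqrt_nonneg _
      have hd := hb.trans (mul_le_mul_of_nonneg_left hc (const_nonneg n k))
      gcongr
    · rw [euclNorm_contr_zero φ g hg]
      simp
  have h2 : (((m + k).choose k : ℕ) : ℝ) * k.factorial * m.factorial = (m + k).factorial := by
    have := Nat.choose_mul_factorial_mul_factorial (Nat.le_add_left k m)
    rw [Nat.add_sub_cancel] at this
    exact_mod_cast this
  have h3 : (0 : ℝ) < ((m + k).choose k : ℕ) := by
    exact_mod_cast Nat.choose_pos (Nat.le_add_left k m)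
  have h4 : (0 : ℝ) < k.factorial * m.factorial := by positivity
  rw [div_mul_eq_mul_div, div_mul_eq_mul_div, le_div_iff₀ h3]
  rw [← h2] at h1
  refine le_of_mul_le_mul_left ?_ h4
  linarith

/-- Proposition 2.5: for `1 ≤ k < p < n`,
`C_{n,p}² ≤ (binom(n,p-k)/binom(p,k)) · C_{n,k}²`. -/
theorem comass_const_sq_le_ratio_mul (n p k : ℕ) (h1 : 1 ≤ k) (h2 : k < p) (h3 : p < n) :
    normComparisonConst n p ^ 2 ≤
      ((n.choose (p - k) : ℝ) / (p.choose k : ℝ)) * normComparisonConst n k ^ 2 := by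
  obtain ⟨m, rfl⟩ : ∃ m, p = m + k := ⟨p - k, by omega⟩
  rw [Nat.add_sub_cancel]
  set R := ((n.choose m : ℝ) / ((m + k).choose k : ℝ)) * normComparisonConst n k ^ 2 with hR
  have hR0 : 0 ≤ R := by positivity
  rw [← Real.sq_sqrt hR0]
  refine pow_le_pow_left₀ (const_nonneg _ _) ?_ 2
  refine Real.sSup_le ?_ (Real.sqrt_nonneg _)
  rintro r ⟨φ, -, rfl⟩
  refine div_le_of_le_mul₀ (comass_nonneg φ) (Real.sqrt_nonneg _) ?_
  refine (pow_le_pow_iff_left₀ (Real.sqrt_nonneg _)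
    (mul_nonneg (Real.sqrt_nonneg _) (comass_nonneg φ)) two_ne_zero).1 ?_
  rw [mul_pow, Real.sq_sqrt hR0]
  exact main_bound φ
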